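/- Let K ⊆ ℝ^d be a symmetric convex body (compact, convex, nonempty interior, K = −K). Then for every ρ > 0 and every y ∈ ℝ^d, vol_d(K ∩ (y + ρ·B₂^d)) ≤ vol_d(K ∩ ρ·B₂^d), where B₂^d is the closed Euclidean unit ball; i.e., among all translates of a Euclidean ball, the one centered at the origin has maximal intersection volume with K. -/

import Mathlib

open MeasureTheory

open scoped ENNReal Pointwise

lemma bm_compact {A B C : Set ℝ} (hA : IsCompact A) (hB : IsCompact B)
    (hAn : A.Nonempty) (hBn : B.Nonempty) (h : ∀ a ∈ A, ∀ b ∈ B, a + b ∈ C) :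
    volume A + volume B ≤ volume C := by
  obtain ⟨a, ha, ha'⟩ := hA.exists_isGreatest hAn
  obtain ⟨b, hb, hb'⟩ := hB.exists_isLeast hBn
  have e1 : volume ((fun x => -b + x) ⁻¹' A) = volume A := measure_preimage_add _ _ _
  have e2 : volume ((fun x => -a + x) ⁻¹' B) = volume B := measure_preimage_add _ _ _
  have m2 : MeasurableSet ((fun x => -a + x) ⁻¹' B) :=
    hB.measurableSet.preimage (by fun_prop)
  have hi : ((fun x => -b + x) ⁻¹' A) ∩ ((fun x => -a + x) ⁻¹' B) ⊆ {a + b} := by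
    rintro x ⟨h1, h2⟩
    have h3 := ha' h1
    have h4 := hb' h2
    simp only [Set.mem_singleton_iff]
    simp only at h3 h4
    linarith
  have hz : volume (((fun x => -b + x) ⁻¹' A) ∩ ((fun x => -a + x) ⁻¹' B)) = 0 :=
    measure_mono_null hi (by simp)
  have := measure_union_add_inter (μ := volume) ((fun x => -b + x) ⁻¹' A) m2
  rw [hz, add_zero, e1, e2] at this
  rw [← this]
  apply measure_mono
  rintro x (hx | hx)
  · have := h _ hx b hb
    simpa using this
  · have := h a ha _ hx
    simpa using this

lemma bm_meas {A B C : Set ℝ} (hA : MeasurableSet A) (hB : MeasurableSet B)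
    (hAn : A.Nonempty) (hBn : B.Nonempty) (h : ∀ a ∈ A, ∀ b ∈ B, a + b ∈ C) :
    volume A + volume B ≤ volume C := by
  obtain ⟨a, ha⟩ := hAn
  obtain ⟨b, hb⟩ := hBn
  have key : ∀ K ⊆ A, IsCompact K → ∀ L ⊆ B, IsCompact L →
      volume K + volume L ≤ volume C := by
    intro K hK hKc L hL hLc
    have := bm_compact (C := C) (hKc.insert a) (hLc.insert b) (by simp) (by simp) (by
      intro x hx y hy
      exact h x (Set.insert_subset ha hK hx) y (Set.insert_subset hb hL hy))
    refine le_trans ?_ this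
    gcongr <;> simp
  refine le_of_forall_lt fun r hr => ?_
  by_contra hcon
  push Not at hcon
  refine absurd ?_ (not_le.2 (hcon.trans_lt hr))
  have h1 : ∀ K ⊆ A, IsCompact K → volume K + volume B ≤ volume C := by
    intro K hK hKc
    rw [hB.measure_eq_iSup_isCompact volume]
    rw [ENNReal.add_iSup]
    refine iSup_le fun L => ?_
    by_cases hL : L ⊆ B
    · by_cases hLc : IsCompact L
      · simpa [hL, hLc] using key K hK hKc L hL hLc
      · simpa [hL, hLc] using key K hK hKc ∅ (by simp) (by simp)
    · simpa [hL] using key K hK hKc ∅ (by simp) (by simp)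
  rw [hA.measure_eq_iSup_isCompact volume, ENNReal.iSup_add]
  refine iSup_le fun L => ?_
  by_cases hL : L ⊆ A
  · by_cases hLc : IsCompact L
    · simpa [hL, hLc] using h1 L hL hLc
    · simpa [hL, hLc] using h1 ∅ (by simp) (by simp)
  · simpa [hL] using h1 ∅ (by simp) (by simp)

lemma layer {f : ℝ → ℝ≥0∞} (hf : Measurable f) (h1 : ∀ x, f x ≤ 1) :
    ∫⁻ x, f x = ∫⁻ t in Set.Ioi (0 : ℝ), volume {x | ENNReal.ofReal t < f x} := by
  have hfin : ∀ x, f x ≠ ∞ := fun x => ((h1 x).trans_lt (by simp)).ne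
  have := lintegral_eq_lintegral_meas_lt (f := fun x => (f x).toReal) (volume : Measure ℝ)
    (Filter.Eventually.of_forall fun x => ENNReal.toReal_nonneg) hf.ennreal_toReal.aemeasurable
  simp only [ENNReal.ofReal_toReal (hfin _)] at this
  rw [this]
  refine setLIntegral_congr_fun measurableSet_Ioi fun t ht => ?_
  congr 1
  ext x
  simp only [Set.mem_ofPred_eq]
  rw [ENNReal.ofReal_lt_iff_lt_toReal (le_of_lt ht) (hfin x)]

lemma pl_norm {f g h : ℝ → ℝ≥0∞} (hf : Measurable f) (hg : Measurable g) (hh : Measurable h)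
    (f1 : ⨆ x, f x = 1) (g1 : ⨆ x, g x = 1) (H : ∀ x y, f x * g y ≤ h (x + y) ^ 2) :
    (∫⁻ x, f x) + (∫⁻ x, g x) ≤ ∫⁻ x, h x := by
  have hm : Measurable fun x => min (h x) 1 := hh.min measurable_const
  calc (∫⁻ x, f x) + (∫⁻ x, g x) ≤ ∫⁻ x, min (h x) 1 := by
        rw [layer hf fun x => f1 ▸ le_iSup f x, layer hg fun x => g1 ▸ le_iSup g x,
          layer hm fun x => min_le_right _ _]
        refine (le_lintegral_add _ _).trans ?_
        refine setLIntegral_mono' measurableSet_Ioi fun t ht => ?_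
        by_cases ht1 : ENNReal.ofReal t < 1
        · refine bm_meas (measurableSet_lt measurable_const hf)
            (measurableSet_lt measurable_const hg) ?_ ?_ ?_
          · exact lt_iSup_iff.1 (f1 ▸ ht1)
          · exact lt_iSup_iff.1 (g1 ▸ ht1)
          · intro a ha b hb
            refine lt_min ?_ ht1
            by_contra hc
            push Not at hc
            have h1 : ENNReal.ofReal t * ENNReal.ofReal t < f a * g b := ENNReal.mul_lt_mul ha hb
            have h2 : h (a + b) ^ 2 ≤ ENNReal.ofReal t ^ 2 := by gcongr
            rw [sq (ENNReal.ofReal t)] at h2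
            exact absurd (h1.trans_le (H a b)) (not_lt.2 h2)
        · have e1 : {x | ENNReal.ofReal t < f x} = ∅ := by
            ext x
            simpa using (f1 ▸ le_iSup f x : f x ≤ 1).trans (not_lt.1 ht1)
          have e2 : {x | ENNReal.ofReal t < g x} = ∅ := by
            ext x
            simpa using (g1 ▸ le_iSup g x : g x ≤ 1).trans (not_lt.1 ht1)
          simp [e1, e2]
    _ ≤ ∫⁻ x, h x := lintegral_mono fun x => min_le_left _ _

lemma amgm (X Y : ℝ≥0∞) : 4 * (X * Y) ≤ (X + Y) ^ 2 := by
  rcases eq_or_ne X ∞ with rfl | hX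
  · simp
  rcases eq_or_ne Y ∞ with rfl | hY
  · simp
  lift X to NNReal using hX
  lift Y to NNReal using hY
  norm_cast
  rw [← NNReal.coe_le_coe]
  push_cast
  nlinarith [sq_nonneg ((X : ℝ) - Y)]

lemma pl_bdd {f g h : ℝ → ℝ≥0∞} (hf : Measurable f) (hg : Measurable g) (hh : Measurable h)
    (f1 : ⨆ x, f x ≠ ∞) (g1 : ⨆ x, g x ≠ ∞) (H : ∀ x y, f x * g y ≤ h (x + y) ^ 2) :
    4 * ((∫⁻ x, f x) * ∫⁻ x, g x) ≤ (∫⁻ x, h x) ^ 2 := by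
  set a := ⨆ x, f x with ha
  set b := ⨆ x, g x with hb
  rcases eq_or_ne a 0 with a0 | a0
  · have : ∀ x, f x = 0 := fun x => le_antisymm (a0 ▸ le_iSup f x) (by simp)
    simp [this]
  rcases eq_or_ne b 0 with b0 | b0
  · have : ∀ x, g x = 0 := fun x => le_antisymm (b0 ▸ le_iSup g x) (by simp)
    simp [this]
  obtain ⟨c, hc⟩ : ∃ c : ℝ≥0∞, c ^ 2 = a * b :=
    ⟨(a * b) ^ (1 / 2 : ℝ), by rw [← ENNReal.rpow_natCast, ← ENNReal.rpow_mul]; simp⟩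
  have c0 : c ≠ 0 := by
    rintro rfl
    simp [a0, b0] at hc
  have ct : c ≠ ∞ := by
    rintro rfl
    have := ENNReal.mul_ne_top f1 g1
    rw [← hc] at this
    simp at this
  have key := pl_norm (f := fun x => a⁻¹ * f x) (g := fun x => b⁻¹ * g x)
    (h := fun x => c⁻¹ * h x) (by fun_prop) (by fun_prop) (by fun_prop)
    (by rw [← ENNReal.mul_iSup, ← ha, ENNReal.inv_mul_cancel a0 f1])
    (by rw [← ENNReal.mul_iSup, ← hb, ENNReal.inv_mul_cancel b0 g1])
    (by
      intro x y
      rw [mul_pow, ← ENNReal.inv_pow, hc, ENNReal.mul_inv (Or.inl a0) (Or.inl f1)]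
      calc _ = a⁻¹ * b⁻¹ * (f x * g y) := by ring
        _ ≤ _ := by gcongr; exact H x y)
  rw [lintegral_const_mul _ hf, lintegral_const_mul _ hg, lintegral_const_mul _ hh] at key
  have k2 := (amgm _ _).trans (pow_le_pow_left' key 2)
  have k3 : c ^ 2 * (4 * (a⁻¹ * (∫⁻ x, f x) * (b⁻¹ * ∫⁻ x, g x))) ≤
      c ^ 2 * (c⁻¹ * ∫⁻ x, h x) ^ 2 := by gcongr
  calc 4 * ((∫⁻ x, f x) * ∫⁻ x, g x)
      = (a * a⁻¹) * (b * b⁻¹) * (4 * ((∫⁻ x, f x) * ∫⁻ x, g x)) := by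
        rw [ENNReal.mul_inv_cancel a0 f1, ENNReal.mul_inv_cancel b0 g1]; simp
    _ = c ^ 2 * (4 * (a⁻¹ * (∫⁻ x, f x) * (b⁻¹ * ∫⁻ x, g x))) := by rw [hc]; ring
    _ ≤ _ := k3
    _ = (c * c⁻¹) ^ 2 * (∫⁻ x, h x) ^ 2 := by ring
    _ = _ := by rw [ENNReal.mul_inv_cancel c0 ct]; simp

lemma trunc {f : ℝ → ℝ≥0∞} (hf : Measurable f) :
    ∫⁻ x, f x = ⨆ n : ℕ, ∫⁻ x, min (f x) n := by
  rw [← lintegral_iSup]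
  · congr 1
    ext x
    have : (⨆ n : ℕ, min (f x) (n : ℝ≥0∞)) = min (f x) (⨆ n : ℕ, (n : ℝ≥0∞)) :=
      (inf_iSup_eq _ _).symm
    rw [this, ENNReal.iSup_natCast]
    simp
  · intro n
    exact hf.min measurable_const
  · intro m n hmn x
    exact min_le_min_left _ (by exact_mod_cast hmn)

lemma pl_one {f g h : ℝ → ℝ≥0∞} (hf : Measurable f) (hg : Measurable g) (hh : Measurable h)
    (H : ∀ x y, f x * g y ≤ h (x + y) ^ 2) :
    4 * ((∫⁻ x, f x) * ∫⁻ x, g x) ≤ (∫⁻ x, h x) ^ 2 := by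
  rw [trunc hf, trunc hg, ENNReal.iSup_mul, ENNReal.mul_iSup]
  refine iSup_le fun n => ?_
  rw [ENNReal.mul_iSup, ENNReal.mul_iSup]
  refine iSup_le fun m => ?_
  refine pl_bdd (hf.min measurable_const) (hg.min measurable_const) hh ?_ ?_ ?_
  · exact ((iSup_le fun x => min_le_right _ _).trans_lt (ENNReal.natCast_lt_top n)).ne
  · exact ((iSup_le fun x => min_le_right _ _).trans_lt (ENNReal.natCast_lt_top m)).ne
  · intro x y
    exact (mul_le_mul' (min_le_left _ _) (min_le_left _ _)).trans (H x y)

lemma cons_meas (n : ℕ) :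
    Measurable (fun p : ℝ × (Fin n → ℝ) => (Fin.cons p.1 p.2 : Fin (n + 1) → ℝ)) := by
  refine measurable_pi_iff.2 fun i => ?_
  refine Fin.cases ?_ (fun j => ?_) i
  · simpa using measurable_fst
  · simp only [Fin.cons_succ]
    fun_prop

lemma fub {n : ℕ} {f : (Fin (n + 1) → ℝ) → ℝ≥0∞} (hf : Measurable f) :
    ∫⁻ x, f x = ∫⁻ s : ℝ, ∫⁻ v : Fin n → ℝ, f (Fin.cons s v) := by
  have e := (volume_preserving_piFinSuccAbove (fun _ : Fin (n + 1) => ℝ) 0).symm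
  rw [← lintegral_prod (fun p : ℝ × (Fin n → ℝ) => f (Fin.cons p.1 p.2))
    (hf.comp (cons_meas n)).aemeasurable]
  rw [MeasurePreserving.lintegral_map_equiv f _ e]
  refine lintegral_congr fun a => ?_
  congr 1
  ext i
  refine Fin.cases ?_ (fun j => ?_) i <;> simp [MeasurableEquiv.piFinSuccAbove]

lemma pl (n : ℕ) : ∀ {f g h : (Fin n → ℝ) → ℝ≥0∞}, Measurable f → Measurable g →
    Measurable h → (∀ x y, f x * g y ≤ h (x + y) ^ 2) →
    4 ^ n * ((∫⁻ x, f x) * ∫⁻ x, g x) ≤ (∫⁻ x, h x) ^ 2 := by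
  induction n with
  | zero =>
    intro f g h hf hg hh H
    have : (volume : Measure (Fin 0 → ℝ)) Set.univ = 1 := by
      simp [volume_pi]
    simp only [lintegral_unique, this]
    have := H default default
    rw [Subsingleton.elim (default + default : Fin 0 → ℝ) default] at this
    simp only [mul_one, pow_zero, one_mul]
    convert this using 3
  | succ n ih =>
    intro f g h hf hg hh H
    rw [fub hf, fub hg, fub hh]
    have mf := hf.comp (cons_meas n)
    have mg := hg.comp (cons_meas n)
    have mh := hh.comp (cons_meas n)
    have m2: Measurable fun s : ℝ => ∫⁻ v : Fin n → ℝ, f (Fin.cons s v) :=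
      mf.lintegral_prod_right' (ν := volume)
    have m3 := mg.lintegral_prod_right' (ν := volume)
    have m4 := mh.lintegral_prod_right' (ν := volume)
    have key := pl_one (f := fun s => 4 ^ n * ∫⁻ v : Fin n → ℝ, f (Fin.cons s v))
      (g := fun s => ∫⁻ v : Fin n → ℝ, g (Fin.cons s v))
      (h := fun s => ∫⁻ v : Fin n → ℝ, h (Fin.cons s v)) (m2.const_mul _) m3 m4 (by
        intro s t
        rw [mul_assoc]
        refine ih (mf.comp measurable_prodMk_left) (mg.comp measurable_prodMk_left)
          (mh.comp measurable_prodMk_left) ?_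
        intro x y
        have e : (Fin.cons (s + t) (x + y) : Fin (n + 1) → ℝ) = Fin.cons s x + Fin.cons t y := by
          ext i
          refine Fin.cases ?_ (fun j => ?_) i <;> simp
        simp only [Function.comp, e]
        exact H _ _)
    rw [lintegral_const_mul _ m2] at key
    refine le_trans (le_of_eq ?_) key
    ring

lemma bm (d : ℕ) {A B C : Set (EuclideanSpace ℝ (Fin d))} (hA : MeasurableSet A)
    (hB : MeasurableSet B) (hC : MeasurableSet C) (h : ∀ a ∈ A, ∀ b ∈ B, a + b ∈ C) :
    4 ^ d * (volume A * volume B) ≤ volume C ^ 2 := by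
  have mp := PiLp.volume_preserving_toLp (Fin d)
  rw [← mp.measure_preimage hA.nullMeasurableSet, ← mp.measure_preimage hB.nullMeasurableSet,
    ← mp.measure_preimage hC.nullMeasurableSet]
  have mA := mp.measurable hA
  have mB := mp.measurable hB
  have mC := mp.measurable hC
  rw [← lintegral_indicator_one mA, ← lintegral_indicator_one mB, ← lintegral_indicator_one mC]
  refine pl d (measurable_one.indicator mA) (measurable_one.indicator mB)
    (measurable_one.indicator mC) ?_
  intro x y
  by_cases hx : WithLp.toLp 2 x ∈ A
  · by_cases hy : WithLp.toLp 2 y ∈ B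
    · have := h _ hx _ hy
      rw [← WithLp.toLp_add] at this
      rw [Set.indicator_of_mem (s := WithLp.toLp 2 ⁻¹' C) this]
      simp [Set.indicator, hx, hy]
    · simp [Set.indicator, hy]
  · simp [Set.indicator, hx]

theorem stmt8 (d : ℕ) (K : Set (EuclideanSpace ℝ (Fin d)))
    (hKcompact : IsCompact K) (hKconv : Convex ℝ K) (hKint : (interior K).Nonempty)
    (hKsymm : ∀ x ∈ K, -x ∈ K)
    (ρ : ℝ) (hρ : 0 < ρ) (y : EuclideanSpace ℝ (Fin d)) :
    volume (K ∩ Metric.closedBall y ρ) ≤ volume (K ∩ Metric.closedBall 0 ρ) := by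
  have mA : MeasurableSet (K ∩ Metric.closedBall y ρ) :=
    hKcompact.measurableSet.inter Metric.isClosed_closedBall.measurableSet
  have mC : MeasurableSet (K ∩ Metric.closedBall 0 ρ) :=
    hKcompact.measurableSet.inter Metric.isClosed_closedBall.measurableSet
  have key := bm d mA mA.neg (mC.const_smul₀ (2 : ℝ)) (by
    rintro a ⟨ha, ha'⟩ b hb
    obtain ⟨hb, hb'⟩ : -b ∈ K ∩ Metric.closedBall y ρ := hb
    refine ⟨(1 / 2 : ℝ) • a + (1 / 2 : ℝ) • b, ⟨?_, ?_⟩, ?_⟩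
    · exact hKconv ha (by simpa using hKsymm _ hb) (by norm_num) (by norm_num) (by norm_num)
    · rw [Metric.mem_closedBall, dist_eq_norm] at ha' hb' ⊢
      have e : (1 / 2 : ℝ) • a + (1 / 2 : ℝ) • b - 0 = (1 / 2 : ℝ) • ((a - y) - (-b - y)) := by
        module
      rw [e, norm_smul]
      have := norm_sub_le (a - y) (-b - y)
      rw [Real.norm_of_nonneg (by norm_num)]
      linarith
    · simp only
      module)
  rw [Measure.measure_neg, Measure.addHaar_smul] at key
  have e : ENNReal.ofReal |(2 : ℝ) ^ Module.finrank ℝ (EuclideanSpace ℝ (Fin d))| = 2 ^ d := by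
    rw [finrank_euclideanSpace_fin, abs_of_pos (by positivity),
      ENNReal.ofReal_pow (by norm_num)]
    simp
  have e4 : (4 : ℝ≥0∞) ^ d = (2 ^ d) ^ 2 := by
    rw [← pow_mul, mul_comm, pow_mul]; norm_num
  rw [e, e4, ← sq, ← mul_pow] at key
  have k2 := (ENNReal.pow_le_pow_left_iff (two_ne_zero)).1 key
  exact (ENNReal.mul_le_mul_iff_right (by simp) (by simp)).1 k2
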